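/- Let n = n_0 + n_1 with n_0, n_1 ≥ 0, and let σ ∈ {+1,−1}^n be the sign sequence (−,…,−,+,…,+) with n_1 entries −1 followed by n_0 entries +1. Then B_σ := {b ∈ ℤ^n : b_r ≤ 0 for r ≤ n_1 and b_r > 0 for r > n_1} equals B_{≤σ} := {b : N_{[1,s]}(b,0) ≤ σ_1 + ⋯ + σ_s for s = 1,…,n−1, and N_{[1,n]}(b,0) = n_0 − n_1}; in particular, B_σ is a lower set (ideal) in ℤ^n with respect to the sp_{2∞}-Bruhat order ⪯. -/

import Mathlib

/-!
STATEMENT 13: for σ = (−,…,−,+,…,+) with n₁ minuses followed by n₀ pluses,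
B_σ = B_{≤σ}; in particular B_σ is a lower set (ideal) for the sp_{2∞}-Bruhat order.
-/

open Finsupp

/-- The weight lattice of `sp_{2∞}`: finitely supported functions `ℕ → ℤ`. -/
abbrev PC : Type := ℕ →₀ ℤ

/-- `ε_i`. -/
noncomputable def epsC (i : ℕ) : PC := Finsupp.single i 1

/-- Simple roots: `α_0 = −2ε_0` and `α_i = ε_{i−1} − ε_i` for `i ≥ 1`. -/
noncomputable def alphaC (i : ℕ) : PC := if i = 0 then -(2 • epsC 0) else epsC (i - 1) - epsC i

/-- Dominance order: `λ ⊵ μ` iff `λ − μ` is a finite ℕ-linear combination of the `α_i`. -/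
def DomC (lam mu : PC) : Prop :=
  ∃ c : ℕ →₀ ℕ, lam - mu = c.sum fun i k => (k : ℤ) • alphaC i

/-- Partial sum `β_1 + ⋯ + β_s` (entries with index `< s` in 0-based indexing). -/
noncomputable def psumC {n : ℕ} (β : Fin n → PC) (s : ℕ) : PC :=
  ∑ r ∈ Finset.univ.filter (fun r : Fin n => (r : ℕ) < s), β r

/-- Inverse dominance order on `PC^n`. -/
def InvDomC {n : ℕ} (β γ : Fin n → PC) : Prop :=
  psumC β n = psumC γ n ∧ ∀ s : ℕ, 1 ≤ s → s ≤ n → DomC (psumC β s) (psumC γ s)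

/-- `WT(b)`: `wt_r(b) = ε_{b_r−1}` if `b_r > 0` and `−ε_{−b_r}` if `b_r ≤ 0`. -/
noncomputable def wtC {n : ℕ} (b : Fin n → ℤ) : Fin n → PC :=
  fun r => if 0 < b r then epsC (b r - 1).toNat else -epsC (-(b r)).toNat

/-- The `sp_{2∞}`-Bruhat order: `a ⪯ b` iff `WT(a) ⪯ WT(b)` in inverse dominance order. -/
def BruhatC {n : ℕ} (a b : Fin n → ℤ) : Prop := InvDomC (wtC a) (wtC b)

/-- `N_{[1,s]}(b,i) = #{r ≤ s : b_r > i} − #{r ≤ s : b_r ≤ −i}`. -/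
def NC {n : ℕ} (b : Fin n → ℤ) (i : ℤ) (s : ℕ) : ℤ :=
  ((Finset.univ.filter fun r : Fin n => (r : ℕ) < s ∧ i < b r).card : ℤ) -
  ((Finset.univ.filter fun r : Fin n => (r : ℕ) < s ∧ b r ≤ -i).card : ℤ)

/-- The number of positive entries minus the number of nonpositive entries, as a sum of signs. -/
theorem NC_zero_eq_sum {n : ℕ} (b : Fin n → ℤ) (s : ℕ) :
    NC b 0 s =
      ∑ r ∈ Finset.univ.filter (fun r : Fin n => (r : ℕ) < s), if 0 < b r then (1 : ℤ) else -1 := by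
  simp only [NC, neg_zero]
  rw [Finset.sum_ite, ← Finset.filter_filter, ← Finset.filter_filter]
  simp only [Finset.sum_const, nsmul_eq_mul, mul_one, mul_neg, not_lt]
  ring

theorem degree_epsC (i : ℕ) : Finsupp.degree (epsC i) = 1 := by
  simp [epsC]

theorem degree_alphaC_nonpos (i : ℕ) : Finsupp.degree (alphaC i) ≤ 0 := by
  unfold alphaC
  split_ifs
  · simp [degree_epsC]
  · simp [map_sub, degree_epsC]

/-- The coefficient sum is antitone in the dominance order. -/
theorem DomC.degree_le {lam mu : PC} (h : DomC lam mu) :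
    Finsupp.degree lam ≤ Finsupp.degree mu := by
  obtain ⟨c, hc⟩ := h
  rw [← sub_nonpos, ← map_sub, hc, Finsupp.sum, map_sum]
  refine Finset.sum_nonpos fun i _ => ?_
  rw [map_zsmul, smul_eq_mul]
  exact mul_nonpos_of_nonneg_of_nonpos (Int.natCast_nonneg _) (degree_alphaC_nonpos i)

theorem degree_psumC_wtC {n : ℕ} (b : Fin n → ℤ) (s : ℕ) :
    Finsupp.degree (psumC (wtC b) s) = NC b 0 s := by
  rw [NC_zero_eq_sum, psumC, map_sum]
  refine Finset.sum_congr rfl fun r _ => ?_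
  unfold wtC
  split_ifs <;> simp [map_neg, degree_epsC]

theorem BruhatC.NC_le {n : ℕ} {a b : Fin n → ℤ} (h : BruhatC a b) {s : ℕ} (hs : 1 ≤ s)
    (hsn : s ≤ n) : NC a 0 s ≤ NC b 0 s := by
  simpa only [degree_psumC_wtC] using (h.2 s hs hsn).degree_le

theorem BruhatC.NC_eq {n : ℕ} {a b : Fin n → ℤ} (h : BruhatC a b) : NC a 0 n = NC b 0 n := by
  simpa only [degree_psumC_wtC] using congrArg Finsupp.degree h.1

theorem sum_block_signs (n0 n1 : ℕ) :
    ∑ r : Fin (n0 + n1), (if (r : ℕ) < n1 then (-1 : ℤ) else 1) = (n0 : ℤ) - n1 := by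
  rw [Fin.sum_univ_eq_sum_range (fun r => if r < n1 then (-1 : ℤ) else 1), add_comm n0 n1,
    Finset.sum_range_add,
    Finset.sum_congr rfl fun r hr => if_pos (Finset.mem_range.1 hr)]
  simp
  ring

/-- Sign sequences whose partial sums stay below those of `(−,…,−,+,…,+)`, with the same total,
are equal to it; it is enough to compare the partial sums at the jump. -/
theorem eq_block_signs_of_sum_le {n n1 : ℕ} (e : Fin n → ℤ) (he : ∀ r, e r = 1 ∨ e r = -1)
    (hle : ∑ r ∈ Finset.univ.filter (fun r : Fin n => (r : ℕ) < n1), e r ≤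
      ∑ r ∈ Finset.univ.filter (fun r : Fin n => (r : ℕ) < n1),
        if (r : ℕ) < n1 then (-1 : ℤ) else 1)
    (htot : ∑ r, e r = ∑ r : Fin n, if (r : ℕ) < n1 then (-1 : ℤ) else 1) (r : Fin n) :
    e r = if (r : ℕ) < n1 then -1 else 1 := by
  have low : ∀ i ∈ Finset.univ.filter (fun r : Fin n => (r : ℕ) < n1),
      (if (i : ℕ) < n1 then (-1 : ℤ) else 1) ≤ e i := by
    intro i hi
    rw [if_pos (Finset.mem_filter.1 hi).2]
    rcases he i with h | h <;> omega
  have hsum := le_antisymm (Finset.sum_le_sum low) hle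
  have high : ∀ i ∈ Finset.univ.filter (fun r : Fin n => ¬ (r : ℕ) < n1),
      e i ≤ (if (i : ℕ) < n1 then (-1 : ℤ) else 1) := by
    intro i hi
    rw [if_neg (Finset.mem_filter.1 hi).2]
    rcases he i with h | h <;> omega
  rw [← Finset.sum_filter_add_sum_filter_not Finset.univ (fun r : Fin n => (r : ℕ) < n1) e,
    ← Finset.sum_filter_add_sum_filter_not Finset.univ (fun r : Fin n => (r : ℕ) < n1)
      (fun r : Fin n => if (r : ℕ) < n1 then (-1 : ℤ) else 1), hsum] at htot
  by_cases hr : (r : ℕ) < n1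
  · exact ((Finset.sum_eq_sum_iff_of_le low).1 hsum r (by simp [hr])).symm
  · exact (Finset.sum_eq_sum_iff_of_le high).1 (add_left_cancel htot) r
      (Finset.mem_filter.2 ⟨Finset.mem_univ r, hr⟩)

theorem statement_13 (n0 n1 n : ℕ) (hn : n = n0 + n1)
    (σ : Fin n → ℤ) (hσ : ∀ r : Fin n, σ r = if (r : ℕ) < n1 then -1 else 1) :
    ({b : Fin n → ℤ | ∀ r : Fin n, ((r : ℕ) < n1 → b r ≤ 0) ∧ (n1 ≤ (r : ℕ) → 0 < b r)} =
      {b : Fin n → ℤ |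
        (∀ s : ℕ, 1 ≤ s → s < n →
            NC b 0 s ≤ ∑ r ∈ Finset.univ.filter (fun r : Fin n => (r : ℕ) < s), σ r) ∧
        NC b 0 n = (n0 : ℤ) - (n1 : ℤ)}) ∧
    (∀ a b : Fin n → ℤ,
        (∀ r : Fin n, ((r : ℕ) < n1 → b r ≤ 0) ∧ (n1 ≤ (r : ℕ) → 0 < b r)) →
        BruhatC a b →
        (∀ r : Fin n, ((r : ℕ) < n1 → a r ≤ 0) ∧ (n1 ≤ (r : ℕ) → 0 < a r))) := by
  have total : ∑ r, σ r = (n0 : ℤ) - n1 := by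
    subst hn
    rw [← sum_block_signs]
    exact Finset.sum_congr rfl fun r _ => hσ r
  have filter_univ : Finset.univ.filter (fun r : Fin n => (r : ℕ) < n) = Finset.univ := by
    simp
  have NC_of_mem : ∀ b : Fin n → ℤ,
      (∀ r : Fin n, ((r : ℕ) < n1 → b r ≤ 0) ∧ (n1 ≤ (r : ℕ) → 0 < b r)) → ∀ s : ℕ,
      NC b 0 s = ∑ r ∈ Finset.univ.filter (fun r : Fin n => (r : ℕ) < s), σ r := by
    intro b hb s
    rw [NC_zero_eq_sum]
    refine Finset.sum_congr rfl fun r _ => ?_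
    have := hb r
    rw [hσ]
    split_ifs <;> omega
  have mem_of_NC : ∀ b : Fin n → ℤ,
      (∀ s : ℕ, 1 ≤ s → s < n →
        NC b 0 s ≤ ∑ r ∈ Finset.univ.filter (fun r : Fin n => (r : ℕ) < s), σ r) →
      NC b 0 n = (n0 : ℤ) - n1 →
      ∀ r : Fin n, ((r : ℕ) < n1 → b r ≤ 0) ∧ (n1 ≤ (r : ℕ) → 0 < b r) := by
    intro b hle htot r
    have hjump : NC b 0 n1 ≤ ∑ r ∈ Finset.univ.filter (fun r : Fin n => (r : ℕ) < n1), σ r := by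
      rcases Nat.eq_zero_or_pos n1 with h | h
      · simp [NC_zero_eq_sum, h]
      rcases (show n1 ≤ n by omega).lt_or_eq with h' | h'
      · exact hle n1 h h'
      · rw [h', htot, filter_univ, total]
    rw [NC_zero_eq_sum] at hjump htot
    rw [filter_univ, ← total] at htot
    simp only [hσ] at hjump htot
    have := eq_block_signs_of_sum_le _ (fun r => by split_ifs <;> simp) hjump htot r
    split_ifs at this <;> omega
  refine ⟨Set.ext fun b => ⟨fun hb => ⟨fun s _ _ => (NC_of_mem b hb s).le, ?_⟩,
    fun hb => mem_of_NC b hb.1 hb.2⟩, fun a b hb hab => mem_of_NC a ?_ ?_⟩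
  · rw [NC_of_mem b hb, filter_univ, total]
  · exact fun s hs hsn => (hab.NC_le hs hsn.le).trans (NC_of_mem b hb s).le
  · rw [hab.NC_eq, NC_of_mem b hb, filter_univ, total]
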